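/- arXiv:1906.00572 — 3 statements merged into one kernel-verified Lean document; each statement's English description precedes it below -/
import Mathlib

section
/- Let μ > 0, c > 0 and d be real numbers, define f(x) = c·ln(x + μ) + d on (-μ, ∞) and f⁻¹(y) = exp((y - d)/c) - μ. Let a, b > -μ, let β ∈ [0, 1], and set w̃ := (1 - β)·f(a) + β·f(b). Then the following sandwich holds: a + (w̃ - f(a))·(a + μ)/c ≤ f⁻¹(w̃) ≤ (1 - β)·a + β·b ≤ a + (w̃ - f(a))·(b + μ)/c. -/
/-- Sandwich bound from the convergence proof: with w̃ = (1-β)f(a) + βf(b),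
the value f⁻¹(w̃) is bounded below by the tangent-line bound at a and above by
the regular-space average, which in turn is bounded by the slope-f'(b) line. -/
theorem log_update_sandwich
    (μ c d : ℝ) (hμ : 0 < μ) (hc : 0 < c)
    (f finv : ℝ → ℝ)
    (hf : ∀ x, f x = c * Real.log (x + μ) + d)
    (hfinv : ∀ y, finv y = Real.exp ((y - d) / c) - μ)
    (a b : ℝ) (ha : -μ < a) (hb : -μ < b)
    (β : ℝ) (hβ0 : 0 ≤ β) (hβ1 : β ≤ 1)
    (w : ℝ) (hw : w = (1 - β) * f a + β * f b) :
    a + (w - f a) * (a + μ) / c ≤ finv w ∧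
    finv w ≤ (1 - β) * a + β * b ∧
    (1 - β) * a + β * b ≤ a + (w - f a) * (b + μ) / c := by
  obtain ⟨p, hp⟩ : ∃ p, Real.exp p = a + μ := ⟨_, Real.exp_log (by linarith)⟩
  obtain ⟨q, hq⟩ : ∃ q, Real.exp q = b + μ := ⟨_, Real.exp_log (by linarith)⟩
  have hfa : f a = c * p + d := by rw [hf, ← hp, Real.log_exp]
  have hfb : f b = c * q + d := by rw [hf, ← hq, Real.log_exp]
  have hslope (x : ℝ) : (w - f a) * x / c = β * (q - p) * x := by
    rw [hw, hfa, hfb]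
    field_simp
    ring
  have hlog : (w - d) / c = (1 - β) * p + β * q := by
    rw [hw, hfa, hfb]
    field_simp
    ring
  rw [hslope, hslope, hfinv, hlog]
  refine ⟨?_, ?_, ?_⟩
  · have htangent := mul_le_mul_of_nonneg_left (Real.add_one_le_exp (β * (q - p)))
      (Real.exp_pos p).le
    rw [← Real.exp_add, show p + β * (q - p) = (1 - β) * p + β * q by ring, hp] at htangent
    linarith
  · have hconv := convexOn_exp.2 (Set.mem_univ p) (Set.mem_univ q) (sub_nonneg.2 hβ1) hβ0
      (sub_add_cancel 1 β)
    simp only [smul_eq_mul, hp, hq] at hconv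
    linarith
  · have htangent := mul_le_mul_of_nonneg_left (Real.add_one_le_exp (p - q))
      (Real.exp_pos q).le
    rw [← Real.exp_add, add_sub_cancel, hp, hq] at htangent
    linarith [mul_le_mul_of_nonneg_left htangent hβ0]
end

section
/- Let μ > 0, c > 0 and d be real numbers, define f(x) = c·ln(x + μ) + d on (-μ, ∞) and f⁻¹(y) = exp((y - d)/c) - μ. Let a, b > -μ and β ∈ [0, 1], and define the log-space averaging error e := f⁻¹((1 - β)·f(a) + β·f(b)) - ((1 - β)·a + β·b). Then e ≤ 0 and |e| ≤ β·(a - b)·ln((a - b)/(b + μ) + 1). -/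
/-- The log-space averaging error e = f⁻¹((1-β)f(a) + βf(b)) − ((1-β)a + βb)
is nonpositive and bounded in magnitude by β·(a - b)·ln((a - b)/(b + μ) + 1). -/
theorem log_space_averaging_error_bound
    (μ c d : ℝ) (hμ : 0 < μ) (hc : 0 < c)
    (f finv : ℝ → ℝ)
    (hf : ∀ x, f x = c * Real.log (x + μ) + d)
    (hfinv : ∀ y, finv y = Real.exp ((y - d) / c) - μ)
    (a b : ℝ) (ha : -μ < a) (hb : -μ < b)
    (β : ℝ) (hβ0 : 0 ≤ β) (hβ1 : β ≤ 1)
    (e : ℝ) (he : e = finv ((1 - β) * f a + β * f b) - ((1 - β) * a + β * b)) :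
    e ≤ 0 ∧ |e| ≤ β * (a - b) * Real.log ((a - b) / (b + μ) + 1) := by
  have hA : 0 < a + μ := by linarith
  have hB : 0 < b + μ := by linarith
  have hratio : (a - b) / (b + μ) + 1 = (a + μ) / (b + μ) := by
    field_simp
    ring
  have hexponent : ((1 - β) * f a + β * f b - d) / c =
      (1 - β) * Real.log (a + μ) + β * Real.log (b + μ) := by
    rw [hf, hf]
    field_simp
    ring
  rw [hfinv, hexponent] at he
  have hupper := convexOn_exp.2 (Set.mem_univ (Real.log (a + μ)))
    (Set.mem_univ (Real.log (b + μ))) (sub_nonneg.2 hβ1) hβ0 (by ring)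
  simp only [smul_eq_mul, Real.exp_log hA, Real.exp_log hB] at hupper
  have he0 : e ≤ 0 := by linarith
  refine ⟨he0, ?_⟩
  rw [abs_of_nonpos he0, hratio]
  have hlog := Real.log_le_sub_one_of_pos (div_pos hA hB)
  have hsecant : (b + μ) * Real.log ((a + μ) / (b + μ)) ≤ a - b := by
    calc (b + μ) * Real.log ((a + μ) / (b + μ))
        ≤ (b + μ) * ((a + μ) / (b + μ) - 1) := by gcongr
      _ = a - b := by
        field_simp
        ring
  have hfactor : Real.exp ((1 - β) * Real.log (a + μ) + β * Real.log (b + μ)) =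
      (a + μ) * Real.exp (-β * Real.log ((a + μ) / (b + μ))) := by
    rw [Real.log_div hA.ne' hB.ne']
    nth_rewrite 2 [← Real.exp_log hA]
    rw [← Real.exp_add]
    ring_nf
  have htangent := mul_le_mul_of_nonneg_left
    (Real.add_one_le_exp (-β * Real.log ((a + μ) / (b + μ)))) hA.le
  rw [hfactor] at he
  have hscaled := mul_le_mul_of_nonneg_left hsecant hβ0
  linarith
end

section
/- Let μ > 0, c > 0 and d be real numbers, define f(x) = c·ln(x + μ) + d on (-μ, ∞) and f⁻¹(y) = exp((y - d)/c) - μ. Let a, U > -μ, let β₁, β₂ ∈ [0, 1], and set Û := a + β₂·(U - a) (note Û > -μ since Û is a convex combination of a and U). Then |f⁻¹((1 - β₁)·f(a) + β₁·f(Û)) - (a + β₁·(Û - a))| ≤ β₁·β₂·(a - U)·ln(β₂·(a - U)/(Û + μ) + 1), and the right-hand side is nonnegative. -/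
/-- The weighted arithmetic mean of two positive reals exceeds their weighted geometric mean by at
most `t * (x - y) * (log x - log y)`. -/
theorem abs_exp_weighted_log_sub_weighted_mean_le {x y t : ℝ} (hx : 0 < x) (hy : 0 < y)
    (ht0 : 0 ≤ t) (ht1 : t ≤ 1) :
    |Real.exp ((1 - t) * Real.log x + t * Real.log y) - ((1 - t) * x + t * y)| ≤
      t * ((x - y) * (Real.log x - Real.log y)) := by
  have amgm : Real.exp ((1 - t) * Real.log x + t * Real.log y) ≤ (1 - t) * x + t * y := by
    have h := convexOn_exp.2 (Set.mem_univ (Real.log x)) (Set.mem_univ (Real.log y))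
      (sub_nonneg.2 ht1) ht0 (by ring)
    simpa only [smul_eq_mul, Real.exp_log hx, Real.exp_log hy] using h
  have lower : x * (1 - t * (Real.log x - Real.log y)) ≤
      Real.exp ((1 - t) * Real.log x + t * Real.log y) := by
    have hexp : Real.exp ((1 - t) * Real.log x + t * Real.log y) =
        x * Real.exp (-(t * (Real.log x - Real.log y))) := by
      conv_rhs => rw [← Real.exp_log hx, ← Real.exp_add, Real.log_exp]
      ring_nf
    rw [hexp]
    exact mul_le_mul_of_nonneg_left (Real.one_sub_le_exp_neg _) hx.le
  have hlog : y * (Real.log x - Real.log y) ≤ x - y := by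
    have h := Real.log_le_sub_one_of_pos (div_pos hx hy)
    rw [Real.log_div hx.ne' hy.ne'] at h
    calc y * (Real.log x - Real.log y) ≤ y * (x / y - 1) := mul_le_mul_of_nonneg_left h hy.le
      _ = x - y := by field_simp
  rw [abs_of_nonpos (sub_nonpos.2 amgm)]
  linarith [mul_le_mul_of_nonneg_left hlog ht0]


/-- Bound on the deviation of the logarithmic Q-learning update from the exact
regular-space update: with Û = a + β₂(U - a),
|f⁻¹((1-β₁)f(a) + β₁f(Û)) − (a + β₁(Û - a))| ≤ β₁β₂(a - U)·ln(β₂(a - U)/(Û + μ) + 1),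
and the right-hand side is nonnegative. -/
theorem log_qlearning_update_error_bound
    (μ c d : ℝ) (hμ : 0 < μ) (hc : 0 < c)
    (f finv : ℝ → ℝ)
    (hf : ∀ x, f x = c * Real.log (x + μ) + d)
    (hfinv : ∀ y, finv y = Real.exp ((y - d) / c) - μ)
    (a U : ℝ) (ha : -μ < a) (hU : -μ < U)
    (β₁ β₂ : ℝ) (hβ₁0 : 0 ≤ β₁) (hβ₁1 : β₁ ≤ 1) (hβ₂0 : 0 ≤ β₂) (hβ₂1 : β₂ ≤ 1)
    (Uhat : ℝ) (hUhat : Uhat = a + β₂ * (U - a)) :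
    |finv ((1 - β₁) * f a + β₁ * f Uhat) - (a + β₁ * (Uhat - a))| ≤
      β₁ * β₂ * (a - U) * Real.log (β₂ * (a - U) / (Uhat + μ) + 1) ∧
    0 ≤ β₁ * β₂ * (a - U) * Real.log (β₂ * (a - U) / (Uhat + μ) + 1) := by
  have hA : 0 < a + μ := by linarith
  have hB : 0 < Uhat + μ := by
    have h : (0 : ℝ) < (1 - β₂) * (a + μ) + β₂ * (U + μ) :=
      convex_Ioi (0 : ℝ) hA (show 0 < U + μ by linarith) (sub_nonneg.2 hβ₂1) hβ₂0 (by ring)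
    rw [hUhat]
    linarith
  have hratio : β₂ * (a - U) / (Uhat + μ) + 1 = (a + μ) / (Uhat + μ) := by
    rw [div_add_one hB.ne']
    congr 1
    rw [hUhat]
    ring
  have hrhs : β₁ * β₂ * (a - U) * Real.log (β₂ * (a - U) / (Uhat + μ) + 1) =
      β₁ * (((a + μ) - (Uhat + μ)) * (Real.log (a + μ) - Real.log (Uhat + μ))) := by
    rw [hratio, Real.log_div hA.ne' hB.ne', hUhat]
    ring
  have hlhs : finv ((1 - β₁) * f a + β₁ * f Uhat) - (a + β₁ * (Uhat - a)) =
      Real.exp ((1 - β₁) * Real.log (a + μ) + β₁ * Real.log (Uhat + μ)) -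
        ((1 - β₁) * (a + μ) + β₁ * (Uhat + μ)) := by
    have harg : ((1 - β₁) * f a + β₁ * f Uhat - d) / c =
        (1 - β₁) * Real.log (a + μ) + β₁ * Real.log (Uhat + μ) := by
      rw [hf, hf]
      field_simp
      ring
    rw [hfinv, harg]
    ring
  have hbound := abs_exp_weighted_log_sub_weighted_mean_le hA hB hβ₁0 hβ₁1
  rw [hrhs, hlhs]
  exact ⟨hbound, (abs_nonneg _).trans hbound⟩
end
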